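/- For every integer k ≥ 0, the space (P_k(ℝ³))³ of polynomial vector fields of total degree at most k on ℝ³ is the internal direct sum of R_k := {curl v : v ∈ (P_{k+1}(ℝ³))³} and R_k^⊕ := {x ↦ f(x) x : f ∈ P_{k-1}(ℝ³)}; that is, R_k ∩ R_k^⊕ = {0} and every p ∈ (P_k(ℝ³))³ can be written as p = curl v + (x ↦ f(x) x) with v ∈ (P_{k+1}(ℝ³))³ and f ∈ P_{k-1}(ℝ³). -/

import Mathlib

/-- `PolyDeg k` : real polynomial functions `ℝ³ → ℝ` of total degree at most `k`
(with the convention that `PolyDeg k = {0}` for `k < 0`, in particular `P_{-1} = {0}`). -/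
def PolyDeg (k : ℤ) : Set ((Fin 3 → ℝ) → ℝ) :=
  {f | ∃ P : MvPolynomial (Fin 3) ℝ,
    (∀ m ∈ P.support, ((m.sum fun _ e => e : ℕ) : ℤ) ≤ k) ∧
    ∀ x, f x = MvPolynomial.eval x P}

/-- `PolyVec k` : vector fields `ℝ³ → ℝ³` whose three components lie in `PolyDeg k`. -/
def PolyVec (k : ℤ) : Set ((Fin 3 → ℝ) → (Fin 3 → ℝ)) :=
  {v | ∀ i : Fin 3, (fun x => v x i) ∈ PolyDeg k}

/-- Partial derivative in the `i`-th coordinate direction. -/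
noncomputable def pd3 (i : Fin 3) (f : (Fin 3 → ℝ) → ℝ) (x : Fin 3 → ℝ) : ℝ :=
  fderiv ℝ f x (Pi.single i 1)

/-- The curl `∇ × v` of a vector field on `ℝ³`. -/
noncomputable def curl3 (v : (Fin 3 → ℝ) → (Fin 3 → ℝ)) (x : Fin 3 → ℝ) : Fin 3 → ℝ :=
  ![pd3 1 (fun y => v y 2) x - pd3 2 (fun y => v y 1) x,
    pd3 2 (fun y => v y 0) x - pd3 0 (fun y => v y 2) x,
    pd3 0 (fun y => v y 1) x - pd3 1 (fun y => v y 0) x]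

/-- The space `R_k = curl (P_{k+1})³`. -/
noncomputable def Rspace (k : ℤ) : Set ((Fin 3 → ℝ) → (Fin 3 → ℝ)) :=
  {w | ∃ v ∈ PolyVec (k + 1), w = fun x => curl3 v x}

/-- The complement space `R_k^⊕ = x P_{k-1}`. -/
def RspaceOplus (k : ℤ) : Set ((Fin 3 → ℝ) → (Fin 3 → ℝ)) :=
  {w | ∃ f ∈ PolyDeg (k - 1), w = fun x => f x • x}

section

open MvPolynomial

theorem hasFDerivAt_eval {σ : Type*} [Fintype σ] (P : MvPolynomial σ ℝ) (x : σ → ℝ) :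
    HasFDerivAt (fun y => eval y P)
      (∑ i, eval x (pderiv i P) • (ContinuousLinearMap.proj i : (σ → ℝ) →L[ℝ] ℝ)) x := by
  classical
  induction P using MvPolynomial.induction_on with
  | C a => simpa using hasFDerivAt_const a x
  | add p q hp hq =>
    simpa [add_smul, Finset.sum_add_distrib] using! hp.add hq
  | mul_X p j hp =>
    have hX : HasFDerivAt (fun y : σ → ℝ => y j) (ContinuousLinearMap.proj j : (σ → ℝ) →L[ℝ] ℝ) x :=
      hasFDerivAt_apply j x
    convert! hp.mul hX using 1
    · ext y; simp
    · ext y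
      simp [pderiv_X, Pi.single_apply, add_mul, Finset.sum_add_distrib, Finset.mul_sum,
        apply_ite]
      ring_nf

theorem pd3_eval (i : Fin 3) (P : MvPolynomial (Fin 3) ℝ) (x : Fin 3 → ℝ) :
    pd3 i (fun y => eval y P) x = eval x (pderiv i P) := by
  simp [pd3, (hasFDerivAt_eval P x).fderiv, Pi.single_apply]

theorem pderiv_pderiv_comm {σ R : Type*} [CommSemiring R] (i j : σ) (P : MvPolynomial σ R) :
    pderiv i (pderiv j P) = pderiv j (pderiv i P) := by
  classical
  ext m
  simp only [coeff_pderiv]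
  obtain rfl | h := eq_or_ne i j
  · rfl
  · simp [add_right_comm m, h, h.symm, mul_right_comm]

theorem coeff_X_mul_pderiv {σ R : Type*} [CommSemiring R] (i : σ) (P : MvPolynomial σ R)
    (m : σ →₀ ℕ) : coeff m (X i * pderiv i P) = m i * coeff m P := by
  classical
  induction P using MvPolynomial.induction_on' with
  | monomial n a =>
    rw [X_mul_pderiv_monomial, coeff_smul, coeff_monomial, nsmul_eq_mul]
    split_ifs with h
    · rw [h]
    · simp
  | add p q hp hq => simp [mul_add, hp, hq]

/-- The operator `x · ∇ + c` on polynomials. -/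
noncomputable def shiftedEuler (c : ℝ) (P : MvPolynomial (Fin 3) ℝ) : MvPolynomial (Fin 3) ℝ :=
  ∑ i, X i * pderiv i P + C c * P

theorem coeff_shiftedEuler (c : ℝ) (P : MvPolynomial (Fin 3) ℝ) (m : Fin 3 →₀ ℕ) :
    coeff m (shiftedEuler c P) = ((∑ i, m i : ℕ) + c) * coeff m P := by
  simp [shiftedEuler, coeff_X_mul_pderiv, Finset.sum_mul, add_mul, coeff_sum]

theorem shiftedEuler_injective {c : ℝ} (hc : 0 < c) : Function.Injective (shiftedEuler c) := by
  intro P Q h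
  ext m
  have hm := congrArg (MvPolynomial.coeff m) h
  simp only [coeff_shiftedEuler] at hm
  exact mul_left_cancel₀ (by positivity) hm

theorem exists_shiftedEuler_eq {c : ℝ} (hc : 0 < c) (P : MvPolynomial (Fin 3) ℝ) :
    ∃ A, A.support ⊆ P.support ∧ shiftedEuler c A = P := by
  classical
  set A : MvPolynomial (Fin 3) ℝ :=
    ∑ m ∈ P.support, monomial m (coeff m P / ((∑ i, m i : ℕ) + c)) with hA
  have hcoeff (m) : coeff m A = coeff m P / ((∑ i, m i : ℕ) + c) := by
    simp +contextual [hA, coeff_sum, coeff_monomial]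
  refine ⟨A, fun m hm => ?_, ?_⟩
  · rw [mem_support_iff, hcoeff] at hm
    rw [mem_support_iff]
    exact fun h => hm (by simp [h])
  · ext m
    rw [coeff_shiftedEuler, hcoeff]
    exact mul_div_cancel₀ _ (by positivity)

/-- The polynomials of total degree at most the integer `k`. -/
noncomputable def degreeLEInt (k : ℤ) : Submodule ℝ (MvPolynomial (Fin 3) ℝ) :=
  restrictSupport ℝ {m | ((m.sum fun _ e => e : ℕ) : ℤ) ≤ k}

theorem mem_degreeLEInt {k : ℤ} {P : MvPolynomial (Fin 3) ℝ} :
    P ∈ degreeLEInt k ↔ ∀ m ∈ P.support, ((m.sum fun _ e => e : ℕ) : ℤ) ≤ k :=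
  Iff.rfl

theorem mem_polyDeg {k : ℤ} {f : (Fin 3 → ℝ) → ℝ} :
    f ∈ PolyDeg k ↔ ∃ P ∈ degreeLEInt k, ∀ x, f x = eval x P :=
  Iff.rfl

theorem pderiv_mem_degreeLEInt {k : ℤ} {P : MvPolynomial (Fin 3) ℝ} (hP : P ∈ degreeLEInt k)
    (i : Fin 3) : pderiv i P ∈ degreeLEInt (k - 1) := by
  rw [mem_degreeLEInt] at hP ⊢
  intro m hm
  rw [mem_support_iff, coeff_pderiv] at hm
  have h := hP (m + Finsupp.single i 1) (mem_support_iff.2 (left_ne_zero_of_mul hm))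
  rw [Finsupp.sum_add_index' (by simp) (by simp), Finsupp.sum_single_index rfl] at h
  omega

theorem X_mul_mem_degreeLEInt {k : ℤ} {P : MvPolynomial (Fin 3) ℝ} (hP : P ∈ degreeLEInt k)
    (i : Fin 3) : X i * P ∈ degreeLEInt (k + 1) := by
  rw [mem_degreeLEInt] at hP ⊢
  intro m hm
  rw [support_X_mul, Finset.mem_map] at hm
  obtain ⟨n, hn, rfl⟩ := hm
  have h := hP n hn
  rw [addLeftEmbedding_apply, Finsupp.sum_add_index' (by simp) (by simp),
    Finsupp.sum_single_index rfl]
  omega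

/-- The curl on triples of polynomials. -/
noncomputable def polyCurl (V : Fin 3 → MvPolynomial (Fin 3) ℝ) : Fin 3 → MvPolynomial (Fin 3) ℝ :=
  ![pderiv 1 (V 2) - pderiv 2 (V 1),
    pderiv 2 (V 0) - pderiv 0 (V 2),
    pderiv 0 (V 1) - pderiv 1 (V 0)]

theorem curl3_eval (V : Fin 3 → MvPolynomial (Fin 3) ℝ) (x : Fin 3 → ℝ) (i : Fin 3) :
    curl3 (fun y j => eval y (V j)) x i = eval x (polyCurl V i) := by
  fin_cases i <;> simp [curl3, polyCurl, pd3_eval]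

theorem sum_pderiv_polyCurl (V : Fin 3 → MvPolynomial (Fin 3) ℝ) :
    ∑ i, pderiv i (polyCurl V i) = 0 := by
  simp only [polyCurl, Fin.sum_univ_three, Matrix.cons_val, map_sub]
  rw [pderiv_pderiv_comm 1 0, pderiv_pderiv_comm 2 0, pderiv_pderiv_comm 2 1]
  ring

theorem sum_pderiv_X_mul (F : MvPolynomial (Fin 3) ℝ) :
    ∑ i, pderiv i (X i * F) = shiftedEuler 3 F := by
  have h3 : (C 3 : MvPolynomial (Fin 3) ℝ) = 3 := map_ofNat C 3
  simp only [shiftedEuler, pderiv_mul, pderiv_X_self, Fin.sum_univ_three, h3]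
  ring

/-- The cross product `A × x`, for a triple of polynomials `A`. -/
noncomputable def crossX (A : Fin 3 → MvPolynomial (Fin 3) ℝ) : Fin 3 → MvPolynomial (Fin 3) ℝ :=
  ![X 2 * A 1 - X 1 * A 2, X 0 * A 2 - X 2 * A 0, X 1 * A 0 - X 0 * A 1]

theorem polyCurl_crossX_add (A : Fin 3 → MvPolynomial (Fin 3) ℝ) (i : Fin 3) :
    polyCurl (crossX A) i + (∑ j, pderiv j (A j)) * X i = shiftedEuler 2 (A i) := by
  have h2 : (C 2 : MvPolynomial (Fin 3) ℝ) = 2 := map_ofNat C 2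
  fin_cases i <;>
    simp [polyCurl, crossX, shiftedEuler, pderiv_X, Fin.sum_univ_three, h2] <;>
    ring

theorem crossX_mem_degreeLEInt {k : ℤ} {A : Fin 3 → MvPolynomial (Fin 3) ℝ}
    (hA : ∀ i, A i ∈ degreeLEInt k) (i : Fin 3) : crossX A i ∈ degreeLEInt (k + 1) := by
  have h (i j) := X_mul_mem_degreeLEInt (hA j) i
  fin_cases i <;> exact sub_mem (h _ _) (h _ _)

theorem zero_mem_polyDeg (k : ℤ) : (fun _ => 0) ∈ PolyDeg k :=
  mem_polyDeg.2 ⟨0, zero_mem _, by simp⟩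


end

/-- For every integer `k ≥ 0`, `(P_k)³ = R_k ⊕ R_k^⊕`: the intersection is trivial and
every polynomial vector field of degree ≤ k decomposes as `curl v + f x` with
`v ∈ (P_{k+1})³` and `f ∈ P_{k-1}`. -/
theorem statement2 (k : ℕ) :
    Rspace k ∩ RspaceOplus k = {0} ∧
    ∀ p ∈ PolyVec k, ∃ v ∈ PolyVec ((k : ℤ) + 1), ∃ f ∈ PolyDeg ((k : ℤ) - 1),
      ∀ x, p x = curl3 v x + f x • x := by
  constructor
  · refine Set.Subset.antisymm ?_ (Set.singleton_subset_iff.2 ⟨?_, ?_⟩)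
    · rintro _ ⟨⟨v, hv, rfl⟩, f, hf, hw⟩
      choose V _ hV using fun i => mem_polyDeg.1 (hv i)
      obtain ⟨F, -, hF⟩ := mem_polyDeg.1 hf
      obtain rfl : v = fun y j => MvPolynomial.eval y (V j) := by
        ext y j
        exact hV j y
      have hVF (i : Fin 3) : polyCurl V i = MvPolynomial.X i * F := by
        refine MvPolynomial.funext fun x => ?_
        have hx := congrFun (congrFun hw x) i
        rw [curl3_eval] at hx
        simp [hx, hF, mul_comm]
      have hF0 : F = 0 := by
        refine shiftedEuler_injective (c := 3) (by norm_num) ?_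
        rw [← sum_pderiv_X_mul, ← Finset.sum_congr rfl fun i _ => congrArg _ (hVF i),
          sum_pderiv_polyCurl]
        simp [shiftedEuler]
      rw [Set.mem_singleton_iff, hw]
      ext x i
      simp [hF, hF0]
    · refine ⟨fun _ _ => 0, fun _ => zero_mem_polyDeg _, ?_⟩
      ext x i
      fin_cases i <;> simp [curl3, pd3]
    · refine ⟨fun _ => 0, zero_mem_polyDeg _, ?_⟩
      ext x i
      simp
  · intro p hp
    choose P hPk hP using fun i => mem_polyDeg.1 (hp i)
    choose A hAP hA using fun i => exists_shiftedEuler_eq (c := 2) (by norm_num) (P i)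
    have hAk (i) : A i ∈ degreeLEInt k := fun m hm => hPk i (hAP i hm)
    refine ⟨fun y j => MvPolynomial.eval y (crossX A j),
      fun i => mem_polyDeg.2 ⟨_, crossX_mem_degreeLEInt hAk i, fun _ => rfl⟩,
      fun y => MvPolynomial.eval y (∑ j, MvPolynomial.pderiv j (A j)),
      mem_polyDeg.2 ⟨_, sum_mem fun j _ => pderiv_mem_degreeLEInt (hAk j) j, fun _ => rfl⟩,
      fun x => ?_⟩
    ext i
    rw [Pi.add_apply, curl3_eval, hP, ← hA, ← polyCurl_crossX_add]
    simp
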